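/- Let p be an odd prime, Ψ_∞/Ψ a totally ramified ℤ_p-extension of an unramified extension Ψ of ℚ_p, and R_n the ring of integers of the n-th layer Ψ_n. Then for any uniformizer ϖ_{n+1} of R_{n+1}, one has ϖ_{n+1}^p ∈ p·R_{n+1} + R_n. -/

import Mathlib

noncomputable section

open scoped Classical

/-- An additive `ℚ ∪ {∞}`-valued valuation on a field `A`, normalized by `v p = 1`.
This models the `p`-adic valuation `v_p` on (an algebraic closure of) `ℚ_p`,
with the convention `v 0 = ∞`. -/
structure PadicValData (A : Type) [Field A] (p : ℕ) : Type where
  v : A → WithTop ℚ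
  v_top_iff : ∀ x : A, v x = ⊤ ↔ x = 0
  v_mul : ∀ x y : A, v (x * y) = v x + v y
  v_min_le_add : ∀ x y : A, min (v x) (v y) ≤ v (x + y)
  v_coe_p : v (p : A) = 1

variable {p : ℕ} {A : Type} [Field A]

/-- `x ∈ F` is a uniformizer of the `p`-adic field `F` (embedded in `A` by `emb`):
its valuation is minimal among the positive valuations of elements of `F`. -/
def IsUniformizer (vd : PadicValData A p) {F : Type} [Field F] (emb : F →+* A) (x : F) : Prop :=
  x ≠ 0 ∧ 0 < vd.v (emb x) ∧
    ∀ y : F, 0 < vd.v (emb y) → vd.v (emb x) ≤ vd.v (emb y)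

/-- `y` belongs to the `j`-th power `m_F^j` of the maximal ideal of the ring of integers
`O_F` of `F` (embedded in `A` by `emb`): `y` is a multiple, by an element of `O_F`, of a
product of `j` elements of the maximal ideal `m_F`.  (For `j = 0` this says `y ∈ O_F`.) -/
def InMaxIdealPow (vd : PadicValData A p) {F : Type} [Field F] (emb : F →+* A) (j : ℕ)
    (y : A) : Prop :=
  ∃ (u : F) (s : Fin j → F), 0 ≤ vd.v (emb u) ∧ (∀ k, 0 < vd.v (emb (s k))) ∧
    y = emb u * ∏ k, emb (s k)

/-- The lower-numbering ramification set
`G_i = {σ ∈ Gal(L/K) | ∀ x ∈ O_L, σ x - x ∈ m_L^{i+1}}` (with `G_i = G` for `i ≤ -1`). -/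
def lowerRamSet (vd : PadicValData A p) (K L : Type) [Field K] [Field L] [Algebra K L]
    (emb : L →+* A) (i : ℤ) : Set (L ≃ₐ[K] L) :=
  {σ | ∀ x : L, 0 ≤ vd.v (emb x) →
    InMaxIdealPow vd emb (i + 1).toNat (emb (σ x) - emb x)}

/-- The Herbrand function `φ_{L/K}(u) = ∫_0^u dt / (G_0 : G_t)`, where `G_t = G_{⌈t⌉}`. -/
noncomputable def herbrandPhi (vd : PadicValData A p) (K L : Type) [Field K] [Field L]
    [Algebra K L] (emb : L →+* A) (u : ℝ) : ℝ :=
  ∫ t in (0:ℝ)..u,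
    (Nat.card ↥(lowerRamSet vd K L emb ⌈t⌉) : ℝ) /
      (Nat.card ↥(lowerRamSet vd K L emb 0) : ℝ)

/-- The Herbrand function `ψ_{L/K}`, the inverse of `φ_{L/K}`. -/
noncomputable def herbrandPsi (vd : PadicValData A p) (K L : Type) [Field K] [Field L]
    [Algebra K L] (emb : L →+* A) (w : ℝ) : ℝ :=
  Function.invFun (herbrandPhi vd K L emb) w

/-- The upper-numbering ramification set `G^i = G_{ψ_{L/K}(i)}` of `Gal(L/K)`. -/
def upperRamSet (vd : PadicValData A p) (K L : Type) [Field K] [Field L] [Algebra K L]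
    (emb : L →+* A) (i : ℤ) : Set (L ≃ₐ[K] L) :=
  lowerRamSet vd K L emb ⌈herbrandPsi vd K L emb (i : ℝ)⌉

/-- Condition (ram): the upper ramification groups of `L/K` satisfy
`G = G^{-1} = G^0 ⊇ G^1 ⊋ G^2 ⊋ ⋯ ⊋ G^n ⊋ G^{n+1} = {1}`, with `G^i/G^{i+1}` of order `p`
for `1 ≤ i ≤ n` and `G^0/G^1` of order `p - 1`. -/
def RamCond (vd : PadicValData A p) (K L : Type) [Field K] [Field L] [Algebra K L]
    (emb : L →+* A) (n : ℕ) : Prop :=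
  upperRamSet vd K L emb (-1) = Set.univ ∧
  upperRamSet vd K L emb 0 = Set.univ ∧
  (∀ i : ℤ, upperRamSet vd K L emb (i + 1) ⊆ upperRamSet vd K L emb i) ∧
  Nat.card ↥(upperRamSet vd K L emb 0)
    = (p - 1) * Nat.card ↥(upperRamSet vd K L emb 1) ∧
  (∀ i : ℕ, 1 ≤ i → i ≤ n →
    Nat.card ↥(upperRamSet vd K L emb (i : ℤ))
      = p * Nat.card ↥(upperRamSet vd K L emb ((i : ℤ) + 1))) ∧
  upperRamSet vd K L emb ((n : ℤ) + 1) = {1}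

/-- The local resolvent `⟨α|χ⟩ = ∑_{γ ∈ Gal(L/K)} χ(γ) γ(α)`, computed in `A`. -/
noncomputable def localResolvent (K L : Type) [Field K] [Field L] [Algebra K L]
    (emb : L →+* A) (χ : (L ≃ₐ[K] L) → A) (α : L) : A :=
  ∑ᶠ γ : L ≃ₐ[K] L, χ γ * emb (γ α)


/-- `layer` is the tower of layers of a totally ramified `ℤ_p`-extension `Ψ_∞/Ψ`:
`layer n = Ψ_n` is the `n`-th layer, i.e. the unique subextension with
`Gal(Ψ_n/Ψ) ≅ ℤ/p^n`; each layer is Galois and cyclic of degree `p^n` over `Ψ`,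
the layers are increasing with union `Ψ_∞`, and each `Ψ_n/Ψ` is totally ramified
(witnessed by a uniformizer of `Ψ_n` of valuation `p^{-n}`, `Ψ` being unramified
over `ℚ_p`). -/
def IsZpExtensionTower (vd : PadicValData A p) (Ψ Ψinf : Type) [Field Ψ] [Field Ψinf]
    [Algebra Ψ Ψinf] (emb : Ψinf →+* A)
    (layer : ℕ → IntermediateField Ψ Ψinf) : Prop :=
  layer 0 = ⊥ ∧
  (∀ n, layer n ≤ layer (n + 1)) ∧
  (⨆ n, layer n) = ⊤ ∧
  (∀ n, IsGalois Ψ ↥(layer n)) ∧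
  (∀ n, IsCyclic (↥(layer n) ≃ₐ[Ψ] ↥(layer n))) ∧
  (∀ n, Nat.card (↥(layer n) ≃ₐ[Ψ] ↥(layer n)) = p ^ n) ∧
  (∀ n, ∃ x : ↥(layer n),
    IsUniformizer vd (emb.comp ((layer n).val : ↥(layer n) →+* Ψinf)) x ∧
    vd.v ((emb.comp ((layer n).val : ↥(layer n) →+* Ψinf)) x)
      = ((((p : ℚ) ^ n)⁻¹ : ℚ) : WithTop ℚ))

end

namespace S15

/-- valuation at least `k` -/
def GE {L : Type} [Field L] (w : AddValuation L (WithTop ℤ)) (k : ℤ) (x : L) : Prop :=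
  ((k : ℤ) : WithTop ℤ) ≤ w x

section basic
variable {L : Type} [Field L] {w : AddValuation L (WithTop ℤ)}

lemma ge_zero (k : ℤ) : GE w k 0 := by simp [GE]
lemma ge_add {k : ℤ} {x y : L} (hx : GE w k x) (hy : GE w k y) : GE w k (x + y) :=
  w.map_le_add hx hy
lemma ge_sub {k : ℤ} {x y : L} (hx : GE w k x) (hy : GE w k y) : GE w k (x - y) :=
  w.map_le_sub hx hy
lemma ge_neg {k : ℤ} {x : L} (hx : GE w k x) : GE w k (-x) := by
  unfold GE; rw [w.map_neg]; exact hx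
lemma ge_sum {ι : Type} {s : Finset ι} {f : ι → L} {k : ℤ} (h : ∀ i ∈ s, GE w k (f i)) :
    GE w k (∑ i ∈ s, f i) := w.map_le_sum h
lemma ge_mul {k l : ℤ} {x y : L} (hx : GE w k x) (hy : GE w l y) : GE w (k + l) (x * y) := by
  unfold GE at *
  rw [w.map_mul, WithTop.coe_add]; exact add_le_add hx hy
lemma ge_mono {k l : ℤ} {x : L} (h : l ≤ k) (hx : GE w k x) : GE w l x :=
  le_trans (WithTop.coe_le_coe.2 h) hx
lemma ge_one : GE w 0 1 := by simp [GE]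
lemma ge_pow {k : ℤ} {x : L} (hx : GE w k x) (m : ℕ) : GE w (m * k) (x ^ m) := by
  induction m with
  | zero => simpa using ge_one
  | succ m ih =>
    rw [pow_succ]
    have := ge_mul ih hx
    exact ge_mono (by push_cast; linarith) this
lemma ge_pow0 {x : L} (hx : GE w 0 x) (m : ℕ) : GE w 0 (x ^ m) := by
  simpa using ge_pow hx m
lemma ge_nat (m : ℕ) : GE w 0 (m : L) := by
  induction m with
  | zero => simpa using ge_zero 0
  | succ m ih => push_cast; exact ge_add ih ge_one
lemma ge_int (m : ℤ) : GE w 0 (m : L) := by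
  cases m with
  | ofNat m => simpa using ge_nat m
  | negSucc m => rw [Int.cast_negSucc]; exact ge_neg (ge_nat _)
lemma ge_of_eq {k : ℤ} {x : L} (h : w x = (k : WithTop ℤ)) : GE w k x := h.ge
lemma exists_val {x : L} (h : x ≠ 0) : ∃ k : ℤ, w x = (k : WithTop ℤ) := by
  have := (w.ne_top_iff (x := x)).2 h
  exact ⟨(w x).untop this, (WithTop.coe_untop _ _).symm⟩
lemma ge_val {k l : ℤ} {x : L} (h : w x = (k : WithTop ℤ)) : GE w l x ↔ l ≤ k := by
  unfold GE; rw [h]; exact WithTop.coe_le_coe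
lemma val_mul {k l : ℤ} {x y : L} (h : w x = (k : WithTop ℤ)) (h' : w y = (l : WithTop ℤ)) :
    w (x * y) = ((k + l : ℤ) : WithTop ℤ) := by rw [w.map_mul, h, h', WithTop.coe_add]
lemma val_pow {k : ℤ} {x : L} (h : w x = (k : WithTop ℤ)) (m : ℕ) :
    w (x ^ m) = ((m * k : ℤ) : WithTop ℤ) := by
  induction m with
  | zero => simp
  | succ m ih => rw [pow_succ, val_mul ih h]; congr 1; push_cast; ring
lemma val_ne {k : ℤ} {x : L} (h : w x = (k : WithTop ℤ)) : x ≠ 0 := by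
  rintro rfl; simp at h
lemma ge_cancel {k l : ℤ} {x y : L} (hy : w y = (l : WithTop ℤ)) (h : GE w (k + l) (x * y)) :
    GE w k x := by
  by_cases hx : x = 0
  · subst hx; exact ge_zero _
  obtain ⟨m, hm⟩ := exists_val (w := w) hx
  rw [ge_val (val_mul hm hy)] at h
  rw [ge_val hm]; linarith
lemma ge_all {x : L} (h : ∀ k, GE w k x) : x = 0 := by
  by_contra hx
  obtain ⟨m, hm⟩ := exists_val (w := w) hx
  have := h (m+1)
  rw [ge_val hm] at this; linarith
lemma ge_of_pow {x : L} {m : ℕ} (h : GE w 1 (x ^ m)) : GE w 1 x := by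
  by_cases hx : x = 0
  · subst hx; exact ge_zero _
  obtain ⟨k, hk⟩ := exists_val (w := w) hx
  rw [ge_val (val_pow hk m)] at h
  rw [ge_val hk]
  by_contra! hc
  have : (m:ℤ) * k ≤ 0 := mul_nonpos_of_nonneg_of_nonpos (by positivity) (by linarith)
  linarith

lemma distinct {ι : Type} (s : Finset ι) (f : ι → L)
    (h : ∀ i ∈ s, ∀ j ∈ s, f i ≠ 0 → f j ≠ 0 → i ≠ j → w (f i) ≠ w (f j))
    {k : ℤ} (hk : GE w k (∑ i ∈ s, f i)) : ∀ i ∈ s, GE w k (f i) := by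
  classical
  intro i hi
  obtain ⟨m, hm, hmin⟩ := s.exists_min_image (fun i => w (f i)) ⟨i, hi⟩
  suffices GE w k (f m) from le_trans this (hmin i hi)
  by_cases h0 : f m = 0
  · rw [h0]; exact ge_zero _
  have h1 : w (f m) < w (∑ i ∈ s.erase m, f i) := by
    refine w.map_lt_sum (w.ne_top_iff.2 h0) fun j hj => ?_
    have hj' := Finset.mem_erase.1 hj
    refine lt_of_le_of_ne (hmin j hj'.2) ?_
    by_cases hj0 : f j = 0
    · rw [hj0, w.map_zero]; exact w.ne_top_iff.2 h0
    · exact h m hm j hj'.2 h0 hj0 (Ne.symm hj'.1)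
  rw [← Finset.add_sum_erase s f hm] at hk
  unfold GE at *
  rwa [w.map_add_eq_of_lt_left h1] at hk

lemma val_coprime {p : ℕ} (hp : p.Prime) (hwp : GE w 1 (p : L)) {j : ℕ} (hj : ¬ p ∣ j) :
    w (j : L) = ((0 : ℤ) : WithTop ℤ) := by
  have hcop : Nat.Coprime j p := ((Nat.Prime.coprime_iff_not_dvd hp).2 hj).symm
  have key : ¬ GE w 1 (j : L) := by
    intro h
    have hb := Nat.gcd_eq_gcd_ab j p
    rw [hcop.gcd_eq_one] at hb
    have : (1 : L) = j * (Nat.gcdA j p : ℤ) + p * (Nat.gcdB j p : ℤ) := by exact_mod_cast congrArg (Int.cast : ℤ → L) hb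
    have h1 : GE w 1 (1 : L) := by
      rw [this]
      have a1 := ge_mul h (ge_int (w := w) (Nat.gcdA j p))
      have a2 := ge_mul hwp (ge_int (w := w) (Nat.gcdB j p))
      exact ge_add (by simpa using a1) (by simpa using a2)
    rw [ge_val (k := 0) (by simp)] at h1
    norm_num at h1
  by_cases h0 : (j : L) = 0
  · rw [h0] at key; exact absurd (ge_zero _) key
  obtain ⟨k, hk⟩ := exists_val (w := w) h0
  rw [ge_val hk] at key
  have := ge_nat (w := w) j
  rw [ge_val hk] at this
  rw [hk]; congr 1; omega

lemma ge_dvd {p : ℕ} (hwp : GE w 1 (p : L)) {j : ℕ} (hj : p ∣ j) : GE w 1 (j : L) := by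
  obtain ⟨m, rfl⟩ := hj
  push_cast
  simpa using ge_mul hwp (ge_nat m)

/-- geometric sums -/
lemma geom0 {e : L} (he : GE w 0 e) (j : ℕ) : GE w 0 (∑ m ∈ Finset.range j, (1 + e) ^ m) :=
  ge_sum fun m _ => ge_pow0 (ge_add ge_one he) m

lemma geom_eq (e : L) (j : ℕ) : (1 + e) ^ j - 1 = e * ∑ m ∈ Finset.range j, (1 + e) ^ m := by
  have := geom_sum_mul (1 + e) j
  rw [← this]; ring

lemma geom1 {e : L} (he : GE w 1 e) (j : ℕ) :
    GE w 1 ((∑ m ∈ Finset.range j, (1 + e) ^ m) - (j : L)) := by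
  have : (∑ m ∈ Finset.range j, (1 + e) ^ m) - (j : L) =
      ∑ m ∈ Finset.range j, ((1 + e) ^ m - 1) := by simp
  rw [this]
  refine ge_sum fun m _ => ?_
  rw [geom_eq]
  simpa using ge_mul he (geom0 (ge_mono (by norm_num) he) m)

lemma geom_dvd {p : ℕ} (hwp : GE w 1 (p : L)) {e : L} (he : GE w 1 e) {j : ℕ} (hj : p ∣ j) :
    GE w 1 (∑ m ∈ Finset.range j, (1 + e) ^ m) := by
  have := ge_add (geom1 he j) (ge_dvd hwp hj)
  simpa using this

lemma geom_ndvd {p : ℕ} (hp : p.Prime) (hwp : GE w 1 (p : L)) {e : L} (he : GE w 1 e) {j : ℕ}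
    (hj : ¬ p ∣ j) :
    w (∑ m ∈ Finset.range j, (1 + e) ^ m) = ((0 : ℤ) : WithTop ℤ) := by
  have h0 := val_coprime hp hwp hj
  rw [← h0]
  apply w.map_eq_of_lt_sub
  rw [h0]
  exact lt_of_lt_of_le (WithTop.coe_lt_coe.2 (by norm_num)) (geom1 he j)

end basic

/-- totally ramified setup -/
structure Setup {L : Type} [Field L] (w : AddValuation L (WithTop ℤ)) (Ψ : Type) [Field Ψ]
    [Algebra Ψ L] (ϖ : L) (N : ℕ) : Prop where
  pos : 0 < N
  hϖ : w ϖ = ((1 : ℤ) : WithTop ℤ)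
  hΨ : ∀ c : Ψ, c ≠ 0 → ∃ k : ℤ, w (algebraMap Ψ L c) = ((N * k : ℤ) : WithTop ℤ)
  rank : Module.finrank Ψ L = N

section tot
variable {L : Type} [Field L] {w : AddValuation L (WithTop ℤ)} {Ψ : Type} [Field Ψ]
    [Algebra Ψ L] {ϖ : L} {N : ℕ}

lemma term_val (S : Setup w Ψ ϖ N) {c : Ψ} (hc : c ≠ 0) (j : ℕ) :
    ∃ k : ℤ, w (c • ϖ ^ j) = ((N * k + j : ℤ) : WithTop ℤ) := by
  obtain ⟨k, hk⟩ := S.hΨ c hc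
  refine ⟨k, ?_⟩
  rw [Algebra.smul_def, val_mul hk (val_pow S.hϖ j)]; simp

lemma ge_terms (S : Setup w Ψ ϖ N) (c : Fin N → Ψ) {k : ℤ}
    (h : GE w k (∑ j, c j • ϖ ^ (j : ℕ))) (j : Fin N) : GE w k (c j • ϖ ^ (j : ℕ)) := by
  refine distinct Finset.univ _ ?_ h j (Finset.mem_univ _)
  intro a _ b _ ha hb hab heq
  have ha' : c a ≠ 0 := fun h => ha (by simp [h])
  have hb' : c b ≠ 0 := fun h => hb (by simp [h])
  obtain ⟨k1, h1⟩ := term_val S ha' a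
  obtain ⟨k2, h2⟩ := term_val S hb' b
  rw [h1, h2, WithTop.coe_inj] at heq
  apply hab
  have e1 : ((a:ℕ):ℤ) % N = a := Int.emod_eq_of_lt (by positivity) (by exact_mod_cast a.2)
  have e2 : ((b:ℕ):ℤ) % N = b := Int.emod_eq_of_lt (by positivity) (by exact_mod_cast b.2)
  have : ((a:ℕ):ℤ) % N = ((b:ℕ):ℤ) % N := by
    have := congrArg (· % (N:ℤ)) heq
    simpa [Int.add_emod] using this
  rw [e1, e2] at this
  exact Fin.ext (by exact_mod_cast this)

lemma expand (S : Setup w Ψ ϖ N) (x : L) : ∃ c : Fin N → Ψ, x = ∑ j, c j • ϖ ^ (j : ℕ) := by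
  have li : LinearIndependent Ψ (fun j : Fin N => ϖ ^ (j : ℕ)) := by
    rw [Fintype.linearIndependent_iff]
    intro c hc j
    by_contra h
    obtain ⟨k, hk⟩ := term_val S h j
    apply val_ne hk
    apply ge_all (w := w)
    intro k
    apply ge_terms S c
    rw [hc]; exact ge_zero _
  have : Nonempty (Fin N) := ⟨⟨0, S.pos⟩⟩
  let b := basisOfLinearIndependentOfCardEqFinrank li (by simp [S.rank])
  refine ⟨fun j => b.repr x j, ?_⟩
  conv_lhs => rw [← b.sum_repr x]
  simp [b]

/-- coefficient bound -/
lemma coef_ge (S : Setup w Ψ ϖ N) {c : Ψ} {m : ℤ} {j : ℕ} (hj : j < N)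
    (h : GE w (N * m) (c • ϖ ^ j)) : GE w (N * m) (algebraMap Ψ L c) := by
  by_cases hc : c = 0
  · subst hc; rw [map_zero]; exact ge_zero _
  obtain ⟨k, hk⟩ := S.hΨ c hc
  rw [Algebra.smul_def, ge_val (val_mul hk (val_pow S.hϖ j))] at h
  rw [ge_val hk]
  have hN : (0:ℤ) < N := by exact_mod_cast S.pos
  have hj' : (j:ℤ) < N := by exact_mod_cast hj
  have : (N:ℤ) * m < N * (k + 1) := by linarith
  have := lt_of_mul_lt_mul_left this hN.le
  exact mul_le_mul_of_nonneg_left (by linarith) hN.le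

lemma conj_ge_one (S : Setup w Ψ ϖ N) (σ : L ≃ₐ[Ψ] L) : GE w 1 (σ ϖ) := by
  obtain ⟨c, hc⟩ := expand S (ϖ ^ N)
  have hcj : ∀ j, GE w N (algebraMap Ψ L (c j)) := by
    intro j
    have h1 : GE w N (∑ j, c j • ϖ ^ (j : ℕ)) := by
      rw [← hc]; exact ge_of_eq (by simpa using val_pow S.hϖ N)
    have := coef_ge S (m := 1) j.2 (by simpa using ge_terms S c h1 j)
    simpa using this
  have hne : σ ϖ ≠ 0 := by
    simpa using val_ne S.hϖ
  obtain ⟨t, ht⟩ := exists_val (w := w) hne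
  rw [ge_val ht]
  by_contra! hlt
  have h2 : (σ ϖ) ^ N = ∑ j, c j • (σ ϖ) ^ (j : ℕ) := by
    rw [← map_pow, hc]; simp
  have h3 : GE w (N * t + 1) (∑ j, c j • (σ ϖ) ^ (j : ℕ)) := by
    refine ge_sum fun j _ => ?_
    rw [Algebra.smul_def]
    refine ge_mono ?_ (ge_mul (hcj j) (ge_of_eq (val_pow ht j)))
    have hj : ((j:ℕ):ℤ) + 1 ≤ N := by exact_mod_cast j.2
    have hN : (1:ℤ) ≤ N := by exact_mod_cast S.pos
    nlinarith
  rw [← h2, ge_val (val_pow ht N)] at h3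
  linarith

lemma conj_ge (S : Setup w Ψ ϖ N) (σ : L ≃ₐ[Ψ] L) {x : L} {k : ℤ} (h : GE w k x) :
    GE w k (σ x) := by
  obtain ⟨c, rfl⟩ := expand S x
  rw [map_sum]
  refine ge_sum fun j _ => ?_
  have := ge_terms S c h j
  rw [map_smul, map_pow]
  by_cases hc : c j = 0
  · rw [hc, zero_smul]; exact ge_zero _
  obtain ⟨m, hm⟩ := S.hΨ _ hc
  rw [Algebra.smul_def, ge_val (val_mul hm (val_pow S.hϖ j))] at this
  rw [Algebra.smul_def]
  exact ge_mono this (ge_mul (ge_of_eq hm) (ge_pow (conj_ge_one S σ) j))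

lemma wild {p n : ℕ} (hp : p.Prime) (S : Setup w Ψ ϖ N) (hN : N = p ^ n) (hwp : GE w 1 (p : L))
    (σ : L ≃ₐ[Ψ] L) (hσ : σ ^ N = 1) : GE w 2 (σ ϖ - ϖ) := by
  have h0 : ϖ ≠ 0 := val_ne S.hϖ
  have hu : GE w 0 (σ ϖ / ϖ) := by
    apply ge_cancel S.hϖ
    rw [div_mul_cancel₀ _ h0]; simpa using conj_ge_one S σ
  obtain ⟨c, hc⟩ := expand S (σ ϖ / ϖ)
  rw [hc] at hu
  have hcj : ∀ j, GE w 0 (algebraMap Ψ L (c j)) := by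
    intro j
    have := coef_ge S (m := 0) j.2 (by simpa using ge_terms S c hu j)
    simpa using this
  let z : Fin N := ⟨0, S.pos⟩
  set d : L := algebraMap Ψ L (c z) with hd
  have h1 : GE w 1 (σ ϖ / ϖ - d) := by
    rw [hc, ← Finset.add_sum_erase _ _ (Finset.mem_univ z)]
    have : c z • ϖ ^ (z:ℕ) = d := by simp [z, hd, Algebra.smul_def]
    rw [this, add_sub_cancel_left]
    refine ge_sum fun j hj => ?_
    have hj' : 1 ≤ (j:ℕ) := by
      rcases Nat.eq_zero_or_pos (j:ℕ) with h | h
      · exact absurd (Fin.ext h) (Finset.mem_erase.1 hj).1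
      · exact h
    rw [Algebra.smul_def]
    refine ge_mono ?_ (ge_mul (hcj j) (ge_of_eq (val_pow S.hϖ j)))
    simp; exact_mod_cast hj'
  have h2 : GE w 2 (σ ϖ - d * ϖ) := by
    have := ge_mul h1 (ge_of_eq S.hϖ)
    rw [sub_mul, div_mul_cancel₀ _ h0] at this
    simpa using this
  have h3 : ∀ m : ℕ, GE w 2 ((σ ^ m) ϖ - d ^ m * ϖ) := by
    intro m
    induction m with
    | zero => simpa using ge_zero _
    | succ m ih =>
      have e : (σ ^ (m+1)) ϖ - d ^ (m+1) * ϖ =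
          σ ((σ ^ m) ϖ - d ^ m * ϖ) + d ^ m * (σ ϖ - d * ϖ) := by
        have : σ d = d := by simp [hd]
        rw [pow_succ', AlgEquiv.mul_apply, map_sub, map_mul, map_pow, this]; ring
      rw [e]
      refine ge_add (conj_ge S σ ih) ?_
      simpa using ge_mul (ge_pow0 (hcj z) m) h2
  have h4 : GE w 1 (d ^ N - 1) := by
    have := h3 N
    rw [hσ] at this
    apply ge_cancel S.hϖ
    have e : (d ^ N - 1) * ϖ = -((1 : L ≃ₐ[Ψ] L) ϖ - d ^ N * ϖ) := by simp; ring
    rw [e]; exact ge_neg this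
  have h5 : GE w 1 (d - 1) := by
    let O : Subring L :=
      { carrier := {x | GE w 0 x}
        mul_mem' := fun {a b} ha hb => by simpa using ge_mul ha hb
        one_mem' := ge_one
        add_mem' := fun {a b} ha hb => ge_add ha hb
        zero_mem' := ge_zero _
        neg_mem' := fun {a} ha => ge_neg ha }
    let d' : O := ⟨d, hcj z⟩
    obtain ⟨r, hr⟩ := exists_add_pow_prime_pow_eq hp (d' - 1) 1 n
    have hr' := congrArg (Subtype.val) hr
    simp [d'] at hr'
    rw [← hN] at hr'
    apply ge_of_pow (m := N)
    have e : (d - 1) ^ N = (d ^ N - 1) - p * ((d - 1) * r) := by rw [hr']; ring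
    rw [e]
    refine ge_sub h4 ?_
    have := ge_mul hwp (ge_mul (ge_sub (hcj z) ge_one) r.2)
    simpa using this
  have e : σ ϖ - ϖ = (σ ϖ - d * ϖ) + (d - 1) * ϖ := by ring
  rw [e]
  refine ge_add h2 ?_
  simpa using ge_mul h5 (ge_of_eq S.hϖ)

end tot

section step
variable {L : Type} [Field L] {w : AddValuation L (WithTop ℤ)} {Ψ : Type} [Field Ψ]
    [Algebra Ψ L] {ϖ : L} {N : ℕ}

lemma eps (S : Setup w Ψ ϖ N) (σ : L ≃ₐ[Ψ] L) {b : ℤ} (hσ : GE w (b + 1) (σ ϖ - ϖ)) :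
    ∃ e : L, GE w b e ∧ σ ϖ = ϖ * (1 + e) ∧ σ ϖ - ϖ = e * ϖ := by
  have h0 : ϖ ≠ 0 := val_ne S.hϖ
  refine ⟨σ ϖ / ϖ - 1, ?_, by field_simp; ring, by field_simp⟩
  apply ge_cancel S.hϖ
  have : (σ ϖ / ϖ - 1) * ϖ = σ ϖ - ϖ := by field_simp
  rwa [this]

lemma pow_diff (σ : L ≃ₐ[Ψ] L) {e : L} (he : σ ϖ = ϖ * (1 + e)) (j : ℕ) :
    σ (ϖ ^ j) - ϖ ^ j = ϖ ^ j * (e * ∑ m ∈ Finset.range j, (1 + e) ^ m) := by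
  rw [map_pow, he, ← geom_eq, mul_pow]; ring

lemma P1 (S : Setup w Ψ ϖ N) (σ : L ≃ₐ[Ψ] L) {b : ℤ} (hb : 1 ≤ b)
    (hσ : GE w (b + 1) (σ ϖ - ϖ)) {x : L} {k : ℤ} (h : GE w k x) : GE w (k + b) (σ x - x) := by
  obtain ⟨e, he, h1, -⟩ := eps S σ hσ
  obtain ⟨c, rfl⟩ := expand S x
  rw [map_sum, ← Finset.sum_sub_distrib]
  refine ge_sum fun j _ => ?_
  have := ge_terms S c h j
  rw [map_smul, ← smul_sub, pow_diff σ h1, ← smul_mul_assoc]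
  refine ge_mul this ?_
  simpa using ge_mul he (geom0 (ge_mono (by linarith) he) j)

lemma P3 {p : ℕ} (hwp : GE w 1 (p : L)) (hpN : p ∣ N)
    (S : Setup w Ψ ϖ N) (σ : L ≃ₐ[Ψ] L) {b : ℤ} (hb : 1 ≤ b)
    (hσ : GE w (b + 1) (σ ϖ - ϖ)) {x : L} {k : ℤ} (hk : (p : ℤ) ∣ k) (h : GE w k x) :
    GE w (k + b + 1) (σ x - x) := by
  obtain ⟨e, he, h1, -⟩ := eps S σ hσ
  obtain ⟨c, rfl⟩ := expand S x
  rw [map_sum, ← Finset.sum_sub_distrib]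
  refine ge_sum fun j _ => ?_
  have := ge_terms S c h j
  rw [map_smul, ← smul_sub, pow_diff σ h1, ← smul_mul_assoc]
  by_cases hj : p ∣ (j : ℕ)
  · rw [add_assoc]
    exact ge_mul this (ge_mul he (geom_dvd hwp (ge_mono hb he) hj))
  · have hs : GE w (k + 1) (c j • ϖ ^ (j:ℕ)) := by
      by_cases hc : c j = 0
      · rw [hc, zero_smul]; exact ge_zero _
      obtain ⟨m, hm⟩ := term_val S hc j
      rw [ge_val hm] at this ⊢
      rcases this.lt_or_eq with hlt | heq
      · linarith
      · exfalso
        apply hj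
        rw [← Int.natCast_dvd_natCast]
        have h2 : (p:ℤ) ∣ N * m := Dvd.dvd.mul_right (by exact_mod_cast hpN) m
        have : ((j:ℕ):ℤ) = k - N * m := by linarith
        rw [this]; exact dvd_sub hk h2
    have := ge_mul hs (ge_mul he (geom0 (ge_mono (by linarith) he) j))
    exact ge_mono (by linarith) this

lemma step {p n : ℕ} (hp : p.Prime) (S : Setup w Ψ ϖ N) (hN : N = p ^ n) (hpN : p ∣ N)
    (hwp : GE w N (p : L)) (σ : L ≃ₐ[Ψ] L) (hσN : σ ^ N = 1) {b : ℤ} (hb : 1 ≤ b)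
    (hbp : (p : ℤ) ∣ b - 1) (hbN : p * b + 1 ≤ N + b) (hσ : GE w (b + 1) (σ ϖ - ϖ)) :
    GE w (p * b + 1 + 1) ((σ ^ p) ϖ - ϖ) := by
  have hN1 : (1:ℤ) ≤ N := by exact_mod_cast S.pos
  have hwp1 : GE w 1 (p : L) := ge_mono hN1 hwp
  set δ : Module.End Ψ L := σ.toLinearMap - 1 with hδ
  have hδa : ∀ x, δ x = σ x - x := fun x => by simp [hδ]
  set x : L := ϖ ^ (p - 1) with hx
  have hp2 := hp.two_le
  have hxv : w x = (((p:ℤ) - 1 : ℤ) : WithTop ℤ) := by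
    rw [hx, val_pow S.hϖ]; congr 1; push_cast [Nat.cast_sub hp.one_le]; ring
  have d1 : GE w (p - 1 + b) (δ x) := by
    rw [hδa]; exact P1 S σ hb hσ (ge_of_eq hxv)
  have hdv : (p:ℤ) ∣ p - 1 + b := by
    have : (p:ℤ) - 1 + b = p + (b - 1) := by ring
    rw [this]; exact dvd_add dvd_rfl hbp
  have d2 : ∀ m : ℕ, GE w (p - 1 + (m + 2) * b + 1) ((δ ^ (m + 2)) x) := by
    intro m
    induction m with
    | zero =>
      have := P3 hwp1 hpN S σ hb hσ hdv d1
      rw [← hδa] at this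
      rw [pow_succ', pow_succ', pow_zero, mul_one]
      exact ge_mono (by push_cast; linarith) this
    | succ m ih =>
      have := P1 S σ hb hσ ih
      rw [← hδa] at this
      rw [show m + 1 + 2 = (m + 2) + 1 by ring, pow_succ' δ (m+2)]
      exact ge_mono (by push_cast; linarith) this
  have d3 : ∀ m : ℕ, GE w (p - 1 + b) ((δ ^ (m + 1)) x) := by
    intro m
    cases m with
    | zero => simpa using d1
    | succ m => exact ge_mono (by nlinarith [(by positivity : (0:ℤ) ≤ m)]) (d2 m)
  have hpow : ∀ m : ℕ, ∀ y, (σ ^ m) y = ((1 + δ) ^ m) y := by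
    intro m
    induction m with
    | zero => intro y; simp
    | succ m ih =>
      intro y
      rw [pow_succ, pow_succ, AlgEquiv.mul_apply, Module.End.mul_apply, ih]
      congr 1; simp [hδ]
  have main : (σ ^ p) x - x = ∑ m ∈ Finset.range p, (p.choose (m+1) : L) * (δ ^ (m+1)) x := by
    rw [hpow, add_comm 1 δ, (Commute.one_right δ).add_pow, Finset.sum_range_succ', LinearMap.add_apply,
      LinearMap.sum_apply]
    simp only [one_pow, mul_one, pow_zero, Nat.choose_zero_right, Nat.cast_one, Module.End.one_apply,
      add_sub_cancel_right]
    refine Finset.sum_congr rfl fun m _ => ?_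
    rw [Module.End.mul_apply, Module.End.natCast_apply, map_nsmul, nsmul_eq_mul]
  have big : GE w (p - 1 + (p * b + 1)) ((σ ^ p) x - x) := by
    rw [main]
    refine ge_sum fun m hm => ?_
    rw [Finset.mem_range] at hm
    by_cases hmp : m + 1 = p
    · rw [hmp, Nat.choose_self, Nat.cast_one, one_mul]
      obtain ⟨q, rfl⟩ : ∃ q, p = q + 2 := ⟨p - 2, by omega⟩
      refine ge_mono ?_ (d2 q)
      push_cast; linarith
    · have hdvd : p ∣ p.choose (m+1) := hp.dvd_choose_self (by omega) (by omega)
      obtain ⟨r, hr⟩ := hdvd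
      rw [hr, Nat.cast_mul]
      have := ge_mul (ge_mul hwp (ge_nat r)) (d3 m)
      exact ge_mono (by linarith) this
  have hw := wild hp S hN hwp1 (σ ^ p) (by rw [← pow_mul, mul_comm, pow_mul, hσN, one_pow])
  obtain ⟨e, he, h1, h2⟩ := eps S (σ ^ p) (b := 1) (by simpa using hw)
  rw [hx, pow_diff _ h1] at big
  have hnd : ¬ p ∣ p - 1 := fun h => by
    have := Nat.le_of_dvd (by omega) h; omega
  have hg := geom_ndvd hp hwp1 he hnd
  rw [h2]
  refine ge_mul ?_ (ge_of_eq S.hϖ)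
  apply ge_cancel hg
  apply ge_cancel hxv
  rw [hx]
  rw [mul_comm (ϖ ^ (p - 1))] at big
  exact ge_mono (by linarith) big

/-- the ramification bound -/
lemma ram {p n : ℕ} (hp : p.Prime) (S : Setup w Ψ ϖ N) (hN : N = p ^ (n + 1))
    (hwp : GE w N (p : L)) (σ : L ≃ₐ[Ψ] L) (hσN : σ ^ N = 1) (j : ℕ) (hj : j ≤ n) :
    ∃ b : ℤ, 1 ≤ b ∧ (p : ℤ) ∣ b - 1 ∧ (p - 1) * b = p ^ (j + 1) - 1 ∧
      GE w (b + 1) ((σ ^ (p ^ j)) ϖ - ϖ) := by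
  have hN1 : (1:ℤ) ≤ N := by exact_mod_cast S.pos
  have hwp1 : GE w 1 (p : L) := ge_mono hN1 hwp
  have hp2 : (2:ℤ) ≤ p := by exact_mod_cast hp.two_le
  induction j with
  | zero =>
    refine ⟨1, le_rfl, by simp, by ring, ?_⟩
    simpa using wild hp S hN hwp1 σ hσN
  | succ j ih =>
    obtain ⟨b, hb, hbp, hbe, hg⟩ := ih (by omega)
    refine ⟨p * b + 1, by nlinarith, by simp, ?_, ?_⟩
    · have : ((p:ℤ) - 1) * (p * b + 1) = p * ((p - 1) * b) + (p - 1) := by ring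
      rw [this, hbe]; ring
    · have h1 : (p:ℤ) ^ (j+1) ≤ N := by
        rw [hN]; exact_mod_cast Nat.pow_le_pow_right hp.pos (by omega)
      have := step hp S hN (hN ▸ dvd_pow_self p (by omega)) hwp (σ ^ (p ^ j))
        (by rw [← pow_mul, mul_comm, pow_mul, hσN, one_pow]) hb hbp
        (by linarith) hg
      rwa [← pow_mul, ← pow_succ] at this

end step

section final
open Polynomial
variable {L : Type} [Field L] {w : AddValuation L (WithTop ℤ)} {Ψ : Type} [Field Ψ]
    [Algebra Ψ L] {ϖ : L} {N : ℕ}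

lemma ge_prod {ι : Type} (s : Finset ι) (f : ι → L) {b : ℤ} (h : ∀ i ∈ s, GE w b (f i)) :
    GE w (s.card * b) (∏ i ∈ s, f i) := by
  classical
  induction s using Finset.induction_on with
  | empty => simpa using ge_one
  | insert a s ha ih =>
    rw [Finset.prod_insert ha, Finset.card_insert_of_notMem ha]
    refine ge_mono ?_ (ge_mul (h a (by simp)) (ih fun i hi => h i (by simp [hi])))
    push_cast; linarith

lemma final {p n : ℕ} (hp : p.Prime) (S : Setup w Ψ ϖ N) (hN : N = p ^ (n + 1))
    (hwp : w (p : L) = ((N : ℤ) : WithTop ℤ)) [IsGalois Ψ L] [IsCyclic (L ≃ₐ[Ψ] L)]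
    (K : IntermediateField Ψ L) (hKr : Module.finrank Ψ K = p ^ n)
    (hK : ∀ a ∈ K, a ≠ 0 → ∃ k : ℤ, w a = ((p * k : ℤ) : WithTop ℤ)) :
    ∃ r s : L, s ∈ K ∧ GE w 0 r ∧ GE w 0 s ∧ ϖ ^ p = p * r + s := by
  classical
  have hN1 : (1:ℤ) ≤ N := by exact_mod_cast S.pos
  have hwp' : GE w N (p : L) := ge_of_eq hwp
  have hwp1 : GE w 1 (p : L) := ge_mono hN1 hwp'
  have hp2 : (2:ℤ) ≤ p := by exact_mod_cast hp.two_le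
  have : FiniteDimensional Ψ L := FiniteDimensional.of_finrank_pos (S.rank ▸ S.pos)
  have hcardG : Nat.card (L ≃ₐ[Ψ] L) = p ^ (n + 1) := by
    rw [IsGalois.card_aut_eq_finrank, S.rank, hN]
  let H := K.fixingSubgroup
  have hcardH : Nat.card H = p := by
    have h1 := Module.finrank_mul_finrank Ψ K L
    rw [hKr, S.rank, hN, pow_succ] at h1
    have h2 : Nat.card H = Module.finrank K L := IsGalois.card_fixingSubgroup_eq_finrank K
    rw [h2]
    exact Nat.eq_of_mul_eq_mul_left (pow_pos hp.pos n) h1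
  have hfix : ∃ b : ℤ, (p - 1) * b = p ^ (n + 1) - 1 ∧ ∀ τ : H, GE w (b + 1) (ϖ - τ.1 ϖ) := by
    obtain ⟨b, hb, -, hbe, -⟩ := ram hp S hN hwp' 1 (one_pow _) n le_rfl
    refine ⟨b, hbe, fun τ => ?_⟩
    obtain ⟨g, hg⟩ := IsCyclic.exists_generator (α := L ≃ₐ[Ψ] L)
    have hog : orderOf g = p ^ (n + 1) := by
      rw [← hcardG]; exact orderOf_eq_card_of_forall_mem_zpowers hg
    obtain ⟨m, hm⟩ := (mem_powers_iff_mem_zpowers (x := g) (y := τ.1)).2 (hg τ.1)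
    have hτp : τ.1 ^ p = 1 := by
      have : τ ^ p = 1 := by rw [← hcardH]; exact pow_card_eq_one'
      simpa using congrArg Subtype.val this
    simp only at hm
    have hdvd : p ^ n ∣ m := by
      rw [← hm, ← pow_mul] at hτp
      have := orderOf_dvd_of_pow_eq_one hτp
      rw [hog, pow_succ] at this
      exact Nat.dvd_of_mul_dvd_mul_right hp.pos this
    obtain ⟨q, rfl⟩ := hdvd
    have hgN : (g ^ q) ^ N = 1 := by
      rw [← pow_mul, mul_comm, pow_mul, hN, ← hog, pow_orderOf_eq_one, one_pow]
    obtain ⟨b', -, -, hbe', hg'⟩ := ram hp S hN hwp' (g ^ q) hgN n le_rfl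
    have : b' = b := mul_left_cancel₀ (by linarith : (p:ℤ) - 1 ≠ 0) (hbe'.trans hbe.symm)
    subst this
    rw [← pow_mul, mul_comm, hm] at hg'
    rw [← neg_sub]; exact ge_neg hg'
  obtain ⟨b, hbe, hfix⟩ := hfix
  have : Fintype H := Fintype.ofFinite H
  have hcardH' : Fintype.card H = p := by rw [← Nat.card_eq_fintype_card]; exact hcardH
  let f : L[X] := MulSemiringAction.charpoly H ϖ
  have hfdef : f = ∏ g : H, (X - C (g • ϖ)) := rfl
  have hmon : f.Monic := MulSemiringAction.monic_charpoly H ϖ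
  have hdeg : f.natDegree = p := by
    rw [hfdef, natDegree_prod_of_monic _ _ fun g _ => monic_X_sub_C _]
    simp [hcardH']
  have hcoef : ∀ i, f.coeff i ∈ K := by
    intro i
    rw [← IsGalois.fixedField_fixingSubgroup K]
    rintro ⟨g, hg⟩
    exact MulSemiringAction.smul_coeff_charpoly ϖ i (⟨g, hg⟩ : H)
  have heval : f.eval ϖ = 0 := MulSemiringAction.eval_charpoly H ϖ
  have hder : (derivative f).eval ϖ = ∏ g ∈ Finset.univ.erase (1 : H), (ϖ - g • ϖ) := by
    rw [hfdef, ← Finset.mul_prod_erase _ _ (Finset.mem_univ (1 : H)), derivative_mul, eval_add,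
      eval_mul, eval_mul]
    simp [eval_prod]
  have hder1 : GE w (p ^ (n+1) + p - 2) ((derivative f).eval ϖ) := by
    rw [hder]
    refine ge_mono ?_ (ge_prod _ _ fun g _ => hfix g)
    rw [Finset.card_erase_of_mem (Finset.mem_univ _), Finset.card_univ, hcardH',
      Nat.cast_sub hp.one_le]
    push_cast; linarith
  have hder2 : (derivative f).eval ϖ =
      ∑ i ∈ Finset.range p, f.coeff (i+1) * (i + 1 : ℕ) * ϖ ^ i := by
    rw [eval_eq_sum_range' (n := p)]
    · simp [coeff_derivative]
    · exact lt_of_lt_of_eq (natDegree_derivative_lt (by rw [hdeg]; exact hp.ne_zero)) hdeg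
  have hterm : ∀ i, i + 1 < p → GE w N (f.coeff (i + 1) * ϖ ^ (i + 1)) := by
    intro i hi
    rw [hder2] at hder1
    have hval : ∀ j, f.coeff (j+1) * (j + 1 : ℕ) * ϖ ^ j ≠ 0 →
        ∃ k : ℤ, w (f.coeff (j+1) * (j + 1 : ℕ) * ϖ ^ j) = ((p * k + j : ℤ) : WithTop ℤ) := by
      intro j hj
      have h1 : f.coeff (j+1) * (j + 1 : ℕ) ≠ 0 := left_ne_zero_of_mul hj
      have h2 : f.coeff (j+1) * (j + 1 : ℕ) ∈ K := K.mul_mem (hcoef _) (natCast_mem K _)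
      obtain ⟨k, hk⟩ := hK _ h2 h1
      refine ⟨k, ?_⟩
      rw [val_mul hk (val_pow S.hϖ j), mul_one]
    have h := distinct (Finset.range p) _ (by
      intro i hi j hj hi0 hj0 hij heq
      obtain ⟨k1, h1⟩ := hval i hi0
      obtain ⟨k2, h2⟩ := hval j hj0
      rw [h1, h2, WithTop.coe_inj] at heq
      apply hij
      rw [Finset.mem_range] at hi hj
      have e1 : (i:ℤ) % p = i := Int.emod_eq_of_lt (by positivity) (by exact_mod_cast hi)
      have e2 : (j:ℤ) % p = j := Int.emod_eq_of_lt (by positivity) (by exact_mod_cast hj)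
      have : (i:ℤ) % p = (j:ℤ) % p := by
        have := congrArg (· % (p:ℤ)) heq
        simpa [Int.add_emod] using this
      rw [e1, e2] at this
      exact_mod_cast this) hder1 i (Finset.mem_range.2 (by omega))
    have hnd : ¬ p ∣ i + 1 := fun h => by
      have := Nat.le_of_dvd (by omega) h; omega
    have hc := val_coprime hp hwp1 hnd
    have e : f.coeff (i+1) * (i + 1 : ℕ) * ϖ ^ i = (f.coeff (i+1) * ϖ ^ i) * (i + 1 : ℕ) := by ring
    rw [e] at h
    have h' : GE w (p ^ (n+1) + p - 2) (f.coeff (i+1) * ϖ ^ i) :=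
      ge_cancel hc (by simpa using h)
    have := ge_mul h' (ge_of_eq S.hϖ)
    rw [mul_assoc, ← pow_succ] at this
    refine ge_mono ?_ this
    rw [hN]; push_cast; linarith
  have hsum : ϖ ^ p = -(∑ i ∈ Finset.range (p - 1), f.coeff (i+1) * ϖ ^ (i+1)) + (- f.coeff 0) := by
    have h1 := heval
    rw [eval_eq_sum_range, hdeg, Finset.sum_range_succ, ← hdeg, hmon.coeff_natDegree, hdeg] at h1
    obtain ⟨q, hq⟩ : ∃ q, p = q + 1 := ⟨p - 1, by have := hp.one_le; omega⟩
    have h2 : ∑ i ∈ Finset.range p, f.coeff i * ϖ ^ i =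
        ∑ i ∈ Finset.range (p - 1), f.coeff (i+1) * ϖ ^ (i+1) + f.coeff 0 := by
      conv_lhs => rw [hq, Finset.sum_range_succ']
      rw [hq]; simp
    rw [h2] at h1
    linear_combination h1
  have hA : GE w N (∑ i ∈ Finset.range (p - 1), f.coeff (i+1) * ϖ ^ (i+1)) :=
    ge_sum fun i hi => hterm i (by have := Finset.mem_range.1 hi; omega)
  set T := ∑ i ∈ Finset.range (p - 1), f.coeff (i+1) * ϖ ^ (i+1) with hT
  have hp0 : (p : L) ≠ 0 := val_ne hwp
  refine ⟨-T / p, -f.coeff 0, K.neg_mem (hcoef 0), ?_, ?_, ?_⟩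
  · apply ge_cancel hwp
    rw [div_mul_cancel₀ _ hp0, zero_add]; exact ge_neg hA
  · have : -f.coeff 0 = ϖ ^ p + T := by rw [hsum]; ring
    rw [this]
    refine ge_add (ge_pow0 (ge_mono (by norm_num) (ge_of_eq S.hϖ)) p) (ge_mono (by linarith) hA)
  · rw [mul_div_cancel₀ _ hp0]; exact hsum

end final

section glue

/-- the valuation attached to the data -/
noncomputable def vA {A : Type} [Field A] {p : ℕ} (vd : PadicValData A p) :
    AddValuation A (WithTop ℚ) :=
  AddValuation.of vd.v ((vd.v_top_iff 0).2 rfl)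
    (by
      have h := vd.v_mul 1 1
      have h1 : vd.v 1 ≠ ⊤ := fun h => one_ne_zero ((vd.v_top_iff 1).1 h)
      obtain ⟨q, hq⟩ := WithTop.ne_top_iff_exists.1 h1
      rw [mul_one, ← hq, ← WithTop.coe_add, WithTop.coe_inj] at h
      rw [← hq, ← WithTop.coe_zero, WithTop.coe_inj]; linarith)
    vd.v_min_le_add vd.v_mul

lemma vA_apply {A : Type} [Field A] {p : ℕ} (vd : PadicValData A p) (x : A) :
    vA vd x = vd.v x := rfl

lemma val_zpow {F : Type} [Field F] (v : AddValuation F (WithTop ℚ)) {x : F} {q : ℚ}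
    (h : v x = (q : WithTop ℚ)) (k : ℤ) : v (x ^ k) = ((k * q : ℚ) : WithTop ℚ) := by
  have hnat : ∀ n : ℕ, v (x ^ n) = ((n * q : ℚ) : WithTop ℚ) := by
    intro n
    induction n with
    | zero => simp
    | succ n ih =>
      rw [pow_succ, v.map_mul, ih, h, ← WithTop.coe_add]; congr 1; push_cast; ring
  have hx : x ≠ 0 := by rintro rfl; simp at h
  cases k with
  | ofNat n => simpa using hnat n
  | negSucc n =>
    have h0 : x ^ (Int.negSucc n) ≠ 0 := zpow_ne_zero _ hx
    obtain ⟨r, hr⟩ := WithTop.ne_top_iff_exists.1 (v.ne_top_iff.2 h0)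
    have h1 : v (x ^ (Int.negSucc n) * x ^ (n+1)) = 0 := by
      rw [zpow_negSucc, inv_mul_cancel₀ (pow_ne_zero _ hx), v.map_one]
    rw [v.map_mul, hnat, ← hr, ← WithTop.coe_add, ← WithTop.coe_zero, WithTop.coe_inj] at h1
    rw [← hr, WithTop.coe_inj]
    push_cast at h1 ⊢
    linarith

lemma disc {F : Type} [Field F] (v : AddValuation F (WithTop ℚ)) {x : F} {M : ℕ} (hM : 0 < M)
    (hx : v x = (((M : ℚ)⁻¹ : ℚ) : WithTop ℚ)) (hmin : ∀ y, 0 < v y → v x ≤ v y)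
    {y : F} (hy : y ≠ 0) : ∃ k : ℤ, v y = ((k / M : ℚ) : WithTop ℚ) := by
  obtain ⟨q, hq⟩ := WithTop.ne_top_iff_exists.1 (v.ne_top_iff.2 hy)
  refine ⟨⌊q * M⌋, ?_⟩
  have hM' : (0:ℚ) < M := by exact_mod_cast hM
  have h1 : v (y * x ^ (-⌊q * M⌋)) = ((q - ⌊q * M⌋ / M : ℚ) : WithTop ℚ) := by
    rw [v.map_mul, ← hq, val_zpow v hx, ← WithTop.coe_add]; congr 1; push_cast; field_simp; ring
  have h2 := Int.floor_le (q * M)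
  have h3 := Int.lt_floor_add_one (q * M)
  have h4 : ¬ 0 < q - ⌊q * M⌋ / M := by
    intro h
    have h5 := hmin (y * x ^ (-⌊q * M⌋)) (by rw [h1]; exact_mod_cast h)
    rw [h1, hx, WithTop.coe_le_coe] at h5
    have : (M:ℚ) * (M:ℚ)⁻¹ ≤ M * (q - ⌊q * M⌋ / M) := mul_le_mul_of_nonneg_left h5 hM'.le
    rw [mul_inv_cancel₀ hM'.ne', mul_sub, mul_div_cancel₀ _ hM'.ne'] at this
    linarith
  rw [← hq, WithTop.coe_inj, eq_div_iff hM'.ne']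
  have h6 : (q - ⌊q * M⌋ / M) * M ≤ 0 := mul_nonpos_of_nonpos_of_nonneg (not_lt.1 h4) hM'.le
  rw [sub_mul, div_mul_cancel₀ _ hM'.ne'] at h6
  linarith

lemma mkw {L : Type} [Field L] (v : AddValuation L (WithTop ℚ)) {N : ℕ} (hN : 0 < N)
    (h : ∀ x : L, x ≠ 0 → ∃ k : ℤ, v x = ((k / N : ℚ) : WithTop ℚ)) :
    ∃ w : AddValuation L (WithTop ℤ),
      (∀ x (k : ℤ), w x = (k : WithTop ℤ) ↔ v x = ((k / N : ℚ) : WithTop ℚ)) ∧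
      (∀ x, GE w 0 x ↔ 0 ≤ v x) := by
  classical
  have hN' : (0:ℚ) < N := by exact_mod_cast hN
  let J : WithTop ℤ → WithTop ℚ := WithTop.map (fun k : ℤ => (k : ℚ) / N)
  have Jc : ∀ k : ℤ, J (k : WithTop ℤ) = ((k / N : ℚ) : WithTop ℚ) := fun k => rfl
  have Jt : J ⊤ = ⊤ := rfl
  have J0 : J 0 = 0 := by
    rw [← WithTop.coe_zero, Jc]; simp
  have Jle : ∀ a b, J a ≤ J b ↔ a ≤ b := by
    intro a b
    induction a using WithTop.recTopCoe with
    | top =>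
      induction b using WithTop.recTopCoe with
      | top => simp
      | coe b => rw [Jt, Jc]; simp
    | coe a =>
      induction b using WithTop.recTopCoe with
      | top => simp [Jt]
      | coe b =>
        rw [Jc, Jc, WithTop.coe_le_coe, WithTop.coe_le_coe, div_le_div_iff_of_pos_right hN', Int.cast_le]
  have Jinj : Function.Injective J := fun a b hab =>
    le_antisymm ((Jle a b).1 hab.le) ((Jle b a).1 hab.ge)
  have Jadd : ∀ a b, J (a + b) = J a + J b := by
    intro a b
    induction a using WithTop.recTopCoe with
    | top => simp [Jt]
    | coe a =>
      induction b using WithTop.recTopCoe with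
      | top => simp [Jt]
      | coe b =>
        rw [← WithTop.coe_add, Jc, Jc, Jc, ← WithTop.coe_add]; congr 1; push_cast; ring
  have hex : ∀ x : L, ∃ a, J a = v x := by
    intro x
    by_cases hx : x = 0
    · exact ⟨⊤, by rw [hx, v.map_zero, Jt]⟩
    · obtain ⟨k, hk⟩ := h x hx
      exact ⟨k, by rw [hk, Jc]⟩
  choose f hf using hex
  refine ⟨AddValuation.of f (Jinj ?_) (Jinj ?_) (fun x y => ?_) (fun x y => Jinj ?_), ?_, ?_⟩
  · rw [hf, v.map_zero, Jt]
  · rw [hf, v.map_one, J0]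
  · have := v.map_add x y
    rw [min_le_iff] at this ⊢
    rwa [← hf, ← hf, ← hf, Jle, Jle] at this
  · rw [hf, v.map_mul, Jadd, hf, hf]
  · intro x k
    rw [AddValuation.of_apply, ← Jc, ← hf, Jinj.eq_iff]
  · intro x
    rw [GE, AddValuation.of_apply, ← hf, ← Jle, WithTop.coe_zero, J0]

end glue

end S15

section

/-- Corollary 3.4. Let `p` be an odd prime, `Ψ_∞/Ψ` a totally
ramified `ℤ_p`-extension of an unramified (finite) extension `Ψ` of `ℚ_p`, and `R_n` the
ring of integers of the `n`-th layer `Ψ_n`.  Then for any uniformizer `ϖ_{n+1}` of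
`R_{n+1}`, one has `ϖ_{n+1}^p ∈ p·R_{n+1} + R_n`. -/
theorem statement15 {p : ℕ} [Fact p.Prime] (hp : Odd p)
    {A : Type} [Field A] (vd : PadicValData A p)
    (Ψ Ψinf : Type) [Field Ψ] [Field Ψinf]
    [Algebra ℚ_[p] Ψ] [FiniteDimensional ℚ_[p] Ψ] [Algebra Ψ Ψinf]
    (emb : Ψinf →+* A)
    (hunram : IsUniformizer vd (emb.comp (algebraMap Ψ Ψinf)) (p : Ψ))
    (layer : ℕ → IntermediateField Ψ Ψinf)
    (htower : IsZpExtensionTower vd Ψ Ψinf emb layer)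
    (n : ℕ) (ϖ : ↥(layer (n + 1)))
    (hϖ : IsUniformizer vd
      (emb.comp ((layer (n + 1)).val : ↥(layer (n + 1)) →+* Ψinf)) ϖ) :
    ∃ (r : ↥(layer (n + 1))) (s : ↥(layer n)),
      0 ≤ vd.v ((emb.comp ((layer (n + 1)).val : ↥(layer (n + 1)) →+* Ψinf)) r) ∧
      0 ≤ vd.v ((emb.comp ((layer n).val : ↥(layer n) →+* Ψinf)) s) ∧
      ((emb.comp ((layer (n + 1)).val : ↥(layer (n + 1)) →+* Ψinf)) ϖ) ^ p
        = (p : A) * (emb.comp ((layer (n + 1)).val : ↥(layer (n + 1)) →+* Ψinf)) r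
            + (emb.comp ((layer n).val : ↥(layer n) →+* Ψinf)) s := by
  classical
  obtain ⟨-, hmono, -, hgal, hcyc, hcard, hunif⟩ := htower
  have hpp : p.Prime := Fact.out
  have hgalL := hgal (n + 1)
  have hcycL := hcyc (n + 1)
  have hpos : ∀ m, 0 < p ^ m := fun m => pow_pos hpp.pos m
  have hfin : ∀ m, FiniteDimensional Ψ (layer m) ∧ Module.finrank Ψ (layer m) = p ^ m := by
    intro m
    have := hgal m
    have hc := hcard m
    have hf : Finite (layer m ≃ₐ[Ψ] layer m) := Nat.finite_of_card_ne_zero (by rw [hc]; exact (hpos m).ne')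
    have hfd : FiniteDimensional Ψ (layer m) := IsGalois.finiteDimensional_of_finite Ψ (layer m)
    exact ⟨hfd, by rw [← IsGalois.card_aut_eq_finrank, hc]⟩
  let vm : ∀ m, AddValuation (layer m) (WithTop ℚ) := fun m =>
    (S15.vA vd).comap (emb.comp ((layer m).val : ↥(layer m) →+* Ψinf))
  have hdisc : ∀ m (y : layer m), y ≠ 0 →
      ∃ k : ℤ, vm m y = ((k / (p ^ m : ℕ) : ℚ) : WithTop ℚ) := by
    intro m y hy
    obtain ⟨x, hx, hv⟩ := hunif m
    refine S15.disc (vm m) (x := x) (hpos m) ?_ hx.2.2 hy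
    push_cast; exact hv
  have hϖv : vm (n+1) ϖ = ((((p ^ (n+1) : ℕ) : ℚ)⁻¹ : ℚ) : WithTop ℚ) := by
    obtain ⟨x, hx, hv⟩ := hunif (n + 1)
    have : vm (n+1) ϖ = vm (n+1) x :=
      le_antisymm (hϖ.2.2 x hx.2.1) (hx.2.2 ϖ hϖ.2.1)
    rw [this]; push_cast; exact hv
  obtain ⟨w, hw, hw0⟩ := S15.mkw (vm (n+1)) (hpos (n+1)) (hdisc (n+1))
  have hNq : ((p ^ (n+1) : ℕ) : ℚ) ≠ 0 := by exact_mod_cast (hpos (n+1)).ne'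
  have hNq' : ((p ^ n : ℕ) : ℚ) ≠ 0 := by exact_mod_cast (hpos n).ne'
  have hpq : (p : ℚ) ≠ 0 := by exact_mod_cast hpp.ne_zero
  have hS : S15.Setup w Ψ ϖ (p ^ (n+1)) := by
    refine ⟨hpos _, ?_, ?_, (hfin _).2⟩
    · rw [hw, hϖv]; congr 1; simp
    · intro c hc
      let vΨ := (S15.vA vd).comap (emb.comp (algebraMap Ψ Ψinf))
      have hvp : vΨ (p : Ψ) = ((((1:ℕ) : ℚ)⁻¹ : ℚ) : WithTop ℚ) := by
        change vd.v _ = _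
        simp [vd.v_coe_p]
      obtain ⟨k, hk⟩ := S15.disc vΨ one_pos hvp hunram.2.2 hc
      refine ⟨k, ?_⟩
      rw [hw]
      change vΨ c = _
      rw [hk]; congr 1
      push_cast at hNq ⊢
      field_simp
  have hwp : w ((p : ℕ) : layer (n+1)) = (((p ^ (n+1) : ℕ) : ℤ) : WithTop ℤ) := by
    rw [hw]
    change vd.v _ = _
    rw [map_natCast, vd.v_coe_p]
    push_cast at hNq ⊢
    rw [div_self hNq]; rfl
  let K := IntermediateField.restrict (hmono n)
  have hKr : Module.finrank Ψ K = p ^ n := by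
    rw [← (hfin n).2]
    exact (IntermediateField.restrictAlgEquiv (hmono n)).toLinearEquiv.finrank_eq.symm
  have hK : ∀ a ∈ K, a ≠ 0 → ∃ k : ℤ, w a = ((p * k : ℤ) : WithTop ℤ) := by
    intro a ha ha0
    have ha' := (IntermediateField.mem_restrict (hmono n) a).1 ha
    obtain ⟨k, hk⟩ := hdisc n ⟨a.1, ha'⟩ (fun h => ha0 (Subtype.ext (by simpa using congrArg (fun z : layer n => (z : Ψinf)) h)))
    refine ⟨k, ?_⟩
    rw [hw]
    change vm n ⟨a.1, ha'⟩ = _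
    rw [hk]; congr 1
    push_cast at hNq hNq' ⊢
    rw [pow_succ]
    field_simp
  obtain ⟨r, s, hsK, hr, hs, he⟩ := S15.final hpp hS rfl hwp K hKr hK
  have hs' := (IntermediateField.mem_restrict (hmono n) s).1 hsK
  refine ⟨r, ⟨s.1, hs'⟩, (hw0 r).1 hr, (hw0 s).1 hs, ?_⟩
  have := congrArg (emb.comp ((layer (n + 1)).val : ↥(layer (n + 1)) →+* Ψinf)) he
  rw [map_pow, map_add, map_mul, map_natCast] at this
  exact this

end
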